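/- Let (M,η,H) be a contact Hamiltonian system and Y a scaling symmetry with constant λ, with Hamiltonian–horizontal decomposition Y = X_{φ_Y} + δ_Y (φ_Y = −η(Y)). Then the contact Hamiltonian vector field X_{φ_Y} is itself a scaling symmetry of the system, [X_{φ_Y}, X_H] = λ X_H; moreover Y is purely Hamiltonian (δ_Y = 0) if and only if the Lie derivative satisfies L_Y η = −R(φ_Y) η. -/

import Mathlib

open scoped BigOperators

/-- Vector fields on the "manifold" whose algebra of smooth functions is `R`,
modeled as ℝ-linear derivations of `R`. -/
abbrev VectorFieldOn (R : Type*) [CommRing R] [Algebra ℝ R] : Type _ := Derivation ℝ R R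

/-- The exterior derivative of a 1-form (an `R`-linear functional on vector fields),
via the intrinsic (Koszul) formula `dη(X,Y) = X(η(Y)) - Y(η(X)) - η([X,Y])`. -/
def dForm {R : Type*} [CommRing R] [Algebra ℝ R]
    (η : VectorFieldOn R →ₗ[R] R) (X Y : VectorFieldOn R) : R :=
  X (η Y) - Y (η X) - η ⁅X, Y⁆

/-- An exact contact manifold of dimension `2n+1`, described through its algebra of
smooth functions `R`: a contact form `eta`, nondegenerate and of maximal rank, with
its Reeb vector field and the contact Hamiltonian vector field assignment `ham`,
each characterized by the usual defining equations (together with uniqueness, which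
is what the contact condition `η ∧ (dη)^n ≠ 0` grants). -/
structure ExactContact (R : Type*) [CommRing R] [Algebra ℝ R] where
  n : ℕ
  eta : VectorFieldOn R →ₗ[R] R
  nondeg : ∀ Z : VectorFieldOn R, eta Z = 0 → (∀ Y, dForm eta Z Y = 0) → Z = 0
  dim_le : ∀ ω : AlternatingMap R (VectorFieldOn R) R (Fin (2 * n + 2)), ω = 0
  reeb : VectorFieldOn R
  reeb_eta : eta reeb = 1
  reeb_dEta : ∀ Y, dForm eta reeb Y = 0
  reeb_unique : ∀ Z, eta Z = 1 → (∀ Y, dForm eta Z Y = 0) → Z = reeb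
  ham : R → VectorFieldOn R
  ham_eta : ∀ f, eta (ham f) = -f
  ham_dEta : ∀ f Y, dForm eta (ham f) Y = Y f - reeb f * eta Y
  ham_unique : ∀ f Z, eta Z = -f → (∀ Y, dForm eta Z Y = Y f - reeb f * eta Y) → Z = ham f

/-- The Jacobi bracket induced by the contact form: `{f,g}_η = X_f(g) + g R(f)`. -/
def ExactContact.jacobi {R : Type*} [CommRing R] [Algebra ℝ R]
    (C : ExactContact R) (f g : R) : R :=
  C.ham f g + g * C.reeb f

section

variable {R : Type*} [CommRing R] [Algebra ℝ R]

theorem dForm_swap (η : VectorFieldOn R →ₗ[R] R) (X Y : VectorFieldOn R) :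
    dForm η X Y = -dForm η Y X := by
  unfold dForm
  rw [← lie_skew X Y, map_neg]
  ring

namespace ExactContact

/-- A contact Hamiltonian vector field rescales the contact form. -/
theorem lieDeriv_eta_ham (C : ExactContact R) (f : R) (Z : VectorFieldOn R) :
    C.ham f (C.eta Z) - C.eta ⁅C.ham f, Z⁆ = -C.reeb f * C.eta Z := by
  have h := C.ham_dEta f Z
  rw [dForm, C.ham_eta, map_neg] at h
  linear_combination h

/-- An infinitesimal contactomorphism is the contact Hamiltonian vector field of `-η(W)`. -/
theorem eq_ham_of_lieDeriv_eta (C : ExactContact R) (W : VectorFieldOn R) (a : R)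
    (h : ∀ Z, W (C.eta Z) - C.eta ⁅W, Z⁆ = a * C.eta Z) : W = C.ham (-C.eta W) := by
  have hd (Z : VectorFieldOn R) : dForm C.eta W Z = a * C.eta Z - Z (C.eta W) := by
    rw [dForm, ← h Z]
    ring
  have ha : a = C.reeb (C.eta W) := by
    have h0 := hd C.reeb
    rw [dForm_swap, C.reeb_dEta, C.reeb_eta] at h0
    linear_combination -h0
  refine C.ham_unique _ W (neg_neg _).symm fun Z => ?_
  rw [hd, ha, map_neg, map_neg]
  ring

/-- Infinitesimal contactomorphisms are closed under the Lie bracket. -/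
theorem lieDeriv_eta_lie (C : ExactContact R) {X Y : VectorFieldOn R} {a b : R}
    (hX : ∀ Z, X (C.eta Z) - C.eta ⁅X, Z⁆ = a * C.eta Z)
    (hY : ∀ Z, Y (C.eta Z) - C.eta ⁅Y, Z⁆ = b * C.eta Z) (Z : VectorFieldOn R) :
    ⁅X, Y⁆ (C.eta Z) - C.eta ⁅⁅X, Y⁆, Z⁆ = (X b - Y a) * C.eta Z := by
  have hXY := congrArg X (hY Z)
  have hYX := congrArg Y (hX Z)
  simp only [map_sub, Derivation.leibniz, smul_eq_mul] at hXY hYX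
  rw [lie_lie, map_sub, Derivation.commutator_apply]
  linear_combination hXY - hYX + hX ⁅Y, Z⁆ - hY ⁅X, Z⁆ - a * hY Z + b * hX Z

/-- The bracket of a horizontal vector field with a contact Hamiltonian one is horizontal. -/
theorem eta_lie_ham_of_horizontal (C : ExactContact R) (H : R) {D : VectorFieldOn R}
    (hD : C.eta D = 0) : C.eta ⁅D, C.ham H⁆ = 0 := by
  have h := C.lieDeriv_eta_ham H D
  rw [hD, map_zero, ← lie_skew, map_neg] at h
  linear_combination h

theorem ham_smul (C : ExactContact R) (r : ℝ) (f : R) : C.ham (r • f) = r • C.ham f := by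
  have hη (Z : VectorFieldOn R) : C.eta (r • Z) = r • C.eta Z := by
    rw [← algebraMap_smul R r Z, map_smul, algebraMap_smul]
  have h := C.eq_ham_of_lieDeriv_eta (r • C.ham f) (-(r • C.reeb f)) fun Z => by
    rw [smul_lie, hη, Derivation.smul_apply, ← smul_sub, C.lieDeriv_eta_ham]
    simp
  rw [h, hη, C.ham_eta, smul_neg, neg_neg]

end ExactContact

end

/-- if `Y` is a scaling symmetry with constant `λ`, then `X_{φ_Y}` is
itself a scaling symmetry, and `Y` is purely Hamiltonian (`δ_Y = 0`) iff
`L_Y η = -R(φ_Y) η`, i.e. `Y(η(Z)) - η([Y,Z]) = -R(φ_Y)·η(Z)` for all `Z`. -/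
theorem scaling_symmetry_hamiltonian_part {R : Type*} [CommRing R] [Algebra ℝ R]
    (C : ExactContact R) (H : R) (Y : VectorFieldOn R) (lam : ℝ)
    (hY : ⁅Y, C.ham H⁆ = lam • C.ham H) :
    ⁅C.ham (-C.eta Y), C.ham H⁆ = lam • C.ham H ∧
      (Y - C.ham (-C.eta Y) = 0 ↔
        ∀ Z : VectorFieldOn R,
          Y (C.eta Z) - C.eta ⁅Y, Z⁆ = -(C.reeb (-C.eta Y)) * C.eta Z) := by
  have hη : C.eta (Y - C.ham (-C.eta Y)) = 0 := by
    rw [map_sub, C.ham_eta, neg_neg, sub_self]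
  constructor
  · have hlie : C.eta ⁅C.ham (-C.eta Y), C.ham H⁆ = C.eta (lam • C.ham H) := by
      have h := C.eta_lie_ham_of_horizontal H hη
      rw [sub_lie, hY, map_sub] at h
      exact (sub_eq_zero.mp h).symm
    rw [C.eq_ham_of_lieDeriv_eta _ _
      (C.lieDeriv_eta_lie (C.lieDeriv_eta_ham _) (C.lieDeriv_eta_ham H)), hlie, ← C.ham_smul,
      C.ham_eta, neg_neg]
  · rw [sub_eq_zero]
    refine ⟨fun h Z => ?_, C.eq_ham_of_lieDeriv_eta Y _⟩
    have h' := C.lieDeriv_eta_ham (-C.eta Y) Z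
    rwa [← h] at h'
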